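/- Let α, β ∈ ℝ and let K_{α,β} be the integral operator on ℝ³ given by (K_{α,β} f)(x) = ⟨x⟩^{−α} ∫_{ℝ³} (4π|x−y|)^{−1} ⟨y⟩^{−β} f(y) dy. If there is a constant C > 0 such that ‖K_{α,β} f‖_{L²(ℝ³)} ≤ C ‖f‖_{L²(ℝ³)} for every nonnegative f ∈ C_0^∞(ℝ³), then β > 1/2. -/

import Mathlib

open MeasureTheory Real

noncomputable section

/-- The Japanese bracket `⟨x⟩ = (1 + |x|²)^{1/2}` on `ℝ³`. -/
def jap (x : EuclideanSpace ℝ (Fin 3)) : ℝ := Real.sqrt (1 + ‖x‖ ^ 2)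

/-- The integral operator `K_{α,β}` on `ℝ³` with kernel `(4π|x-y|)⁻¹ ⟨x⟩^{-α} ⟨y⟩^{-β}`,
i.e. the kernel of `⟨x⟩^{-α} (-Δ)^{-1} ⟨y⟩^{-β}` at spectral parameter `z = 0`. -/
def K (α β : ℝ) (f : EuclideanSpace ℝ (Fin 3) → ℝ) (x : EuclideanSpace ℝ (Fin 3)) : ℝ :=
  jap x ^ (-α) * ∫ y, (4 * π * ‖x - y‖)⁻¹ * jap y ^ (-β) * f y

end

lemma one_le_jap (x : EuclideanSpace ℝ (Fin 3)) : 1 ≤ jap x :=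
  Real.one_le_sqrt.2 (by nlinarith [sq_nonneg ‖x‖])

lemma jap_pos (x : EuclideanSpace ℝ (Fin 3)) : 0 < jap x :=
  one_pos.trans_le (one_le_jap x)

lemma norm_le_jap (x : EuclideanSpace ℝ (Fin 3)) : ‖x‖ ≤ jap x :=
  Real.le_sqrt_of_sq_le (by linarith)

lemma jap_le_one_add_norm (x : EuclideanSpace ℝ (Fin 3)) : jap x ≤ 1 + ‖x‖ :=
  Real.sqrt_le_iff.2 ⟨by positivity, by nlinarith [norm_nonneg x]⟩

lemma contDiff_jap_rpow (s : ℝ) {n : ℕ∞} : ContDiff ℝ n (fun x ↦ jap x ^ s) := by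
  refine ContDiff.rpow_const_of_ne ?_ fun x ↦ (jap_pos x).ne'
  exact (contDiff_const.add (contDiff_norm_sq ℝ)).sqrt fun x ↦ by positivity

lemma not_integrable_jap_rpow_neg_three :
    ¬ Integrable (fun x ↦ jap x ^ (-3 : ℝ)) := by
  intro h
  have h' := (integrable_fun_norm_addHaar volume (E := EuclideanSpace ℝ (Fin 3))
    (f := fun t : ℝ ↦ √(1 + t ^ 2) ^ (-3 : ℝ))).1 h
  have h1 := (h'.mono_set (Set.Ioi_subset_Ioi zero_le_one)).const_mul 8
  refine not_integrableOn_Ioi_inv (a := 1) (h1.mono' (by fun_prop) ?_)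
  refine (ae_restrict_mem measurableSet_Ioi).mono fun t ht ↦ ?_
  have ht : 1 < t := ht
  have ht0 : 0 < t := by linarith
  have hs : √(1 + t ^ 2) ≤ 2 * t := Real.sqrt_le_iff.2 ⟨by positivity, by nlinarith⟩
  have hp : 0 < √(1 + t ^ 2) := by positivity
  have h2 : (2 * t) ^ (-3 : ℝ) ≤ √(1 + t ^ 2) ^ (-3 : ℝ) :=
    Real.rpow_le_rpow_of_nonpos hp hs (by norm_num)
  have h3 : (2 * t) ^ (-3 : ℝ) = ((2 * t) ^ 3)⁻¹ := by
    rw [Real.rpow_neg (by positivity)]; norm_cast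
  rw [h3] at h2
  rw [Real.norm_of_nonneg (by positivity)]
  simp only [finrank_euclideanSpace, Fintype.card_fin, smul_eq_mul]
  calc t⁻¹ = 8 * (t ^ (3 - 1) * ((2 * t) ^ 3)⁻¹) := by norm_num; field_simp; norm_num
    _ ≤ _ := by gcongr

lemma integrable_inv_norm_sub_mul (x : EuclideanSpace ℝ (Fin 3))
    {g : EuclideanSpace ℝ (Fin 3) → ℝ} (hg : Continuous g) (hgs : HasCompactSupport g) :
    Integrable (fun y ↦ ‖x - y‖⁻¹ * g y) := by
  have hloc : LocallyIntegrable (fun z : EuclideanSpace ℝ (Fin 3) ↦ ‖z‖⁻¹) := by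
    refine locallyIntegrable_of_norm_le_rpow (C := 1) (α := 1) (by simp) (by simp) ?_ ?_
    · exact Filter.Eventually.of_forall fun z ↦ by simp [Real.rpow_neg_one]
    · fun_prop
  have h := hloc.integrable_smul_left_of_hasCompactSupport (g := fun z ↦ g (x - z))
    (by fun_prop) (hgs.comp_homeomorph (Homeomorph.subLeft x))
  refine (h.comp_sub_left x).congr (Filter.Eventually.of_forall fun y ↦ ?_)
  simp [mul_comm]

lemma le_K_of_norm_le_one {α β : ℝ} (hβ : β ≤ 1 / 2) {f : EuclideanSpace ℝ (Fin 3) → ℝ}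
    (hf : Continuous f) (hfs : HasCompactSupport f) (hf0 : ∀ x, 0 ≤ f x)
    {x : EuclideanSpace ℝ (Fin 3)} (hx : ‖x‖ ≤ 1) :
    2 ^ (-|α|) * ((8 * π)⁻¹ * ∫ y, jap y ^ (-(3 / 2) : ℝ) * f y) ≤ K α β f x := by
  have hjap (s : ℝ) : Continuous fun y ↦ jap y ^ s := (contDiff_jap_rpow s (n := 0)).continuous
  have h1 : (2 : ℝ) ^ (-|α|) ≤ jap x ^ (-α) :=
    calc (2 : ℝ) ^ (-|α|) ≤ jap x ^ (-|α|) :=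
          Real.rpow_le_rpow_of_nonpos (jap_pos x) (by linarith [jap_le_one_add_norm x])
            (by simp)
      _ ≤ jap x ^ (-α) :=
          Real.rpow_le_rpow_of_exponent_le (one_le_jap x) (neg_le_neg (le_abs_self α))
  refine mul_le_mul h1 ?_ ?_ (Real.rpow_nonneg (jap_pos x).le _)
  · rw [← integral_const_mul]
    refine integral_mono_ae ?_ ?_ ?_
    · exact (((hjap _).mul hf).integrable_of_hasCompactSupport hfs.mul_left).const_mul _
    · refine ((integrable_inv_norm_sub_mul x ((hjap (-β)).mul hf) hfs.mul_left).const_mul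
        (4 * π)⁻¹).congr (Filter.Eventually.of_forall fun y ↦ ?_)
      simp only [mul_inv, Pi.mul_apply]; ring
    · filter_upwards [compl_mem_ae_iff.2 (measure_singleton x)] with y hy
      have hxy : 0 < ‖x - y‖ := norm_pos_iff.2 (sub_ne_zero.2 fun h ↦ hy h.symm)
      have hle : ‖x - y‖ ≤ 2 * jap y := by
        linarith [norm_sub_le x y, norm_le_jap y, one_le_jap y]
      have hj := jap_pos y
      rw [← mul_assoc]
      refine mul_le_mul_of_nonneg_right ?_ (hf0 y)
      calc (8 * π)⁻¹ * jap y ^ (-(3 / 2) : ℝ)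
          = (4 * π * (2 * jap y))⁻¹ * jap y ^ (-(1 / 2) : ℝ) := by
            rw [show (-(3 / 2) : ℝ) = -1 + -(1 / 2) by norm_num, Real.rpow_add hj,
              Real.rpow_neg_one]
            field_simp; norm_num
        _ ≤ (4 * π * ‖x - y‖)⁻¹ * jap y ^ (-β) := by
            gcongr
            exact one_le_jap y
  · exact mul_nonneg (by positivity) (integral_nonneg fun y ↦
      mul_nonneg (Real.rpow_nonneg (jap_pos y).le _) (hf0 y))

lemma eLpNorm_two_eq_sqrt {f : EuclideanSpace ℝ (Fin 3) → ℝ} (hf : MemLp f 2 volume) :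
    eLpNorm f 2 volume = ENNReal.ofReal √(∫ y, f y ^ 2) := by
  rw [hf.eLpNorm_eq_integral_rpow_norm (by simp) (by simp), Real.sqrt_eq_rpow]
  simp

/-- If `K_{α,β}` satisfies an `L²(ℝ³)` bound on nonnegative test functions, then `β > 1/2`. -/
theorem beta_gt_half_of_bounded (α β : ℝ)
    (h : ∃ C > 0, ∀ f : EuclideanSpace ℝ (Fin 3) → ℝ,
      ContDiff ℝ (⊤ : ℕ∞) f → HasCompactSupport f → (∀ x, 0 ≤ f x) →
      eLpNorm (K α β f) 2 volume ≤ ENNReal.ofReal C * eLpNorm f 2 volume) :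
    1 / 2 < β := by
  obtain ⟨C, hC, h⟩ := h
  by_contra! hβ
  set B : Set (EuclideanSpace ℝ (Fin 3)) := Metric.closedBall 0 1
  have hBm : MeasurableSet B := Metric.isClosed_closedBall.measurableSet
  have hBfin : volume B ≠ ⊤ := measure_closedBall_lt_top.ne
  have hV : 0 < √(volume.real B) := Real.sqrt_pos.2
    (ENNReal.toReal_pos (Metric.measure_closedBall_pos volume _ one_pos).ne' hBfin)
  set c : ℝ := 2 ^ (-|α|) * (8 * π)⁻¹ * √(volume.real B)
  have hc : 0 < c := by positivity
  have hjap (s : ℝ) : Continuous fun y ↦ jap y ^ s := (contDiff_jap_rpow s (n := 0)).continuous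
  have hw0 (y) : 0 ≤ jap y ^ (-(3 / 2) : ℝ) := Real.rpow_nonneg (jap_pos y).le _
  have hw2 (y) : jap y ^ (-3 : ℝ) = (jap y ^ (-(3 / 2) : ℝ)) ^ 2 := by
    rw [← Real.rpow_mul_natCast (jap_pos y).le]; norm_num
  refine not_integrable_jap_rpow_neg_three ((aecover_closedBall (x := 0)
    tendsto_natCast_atTop_atTop).integrable_of_integral_bounded_of_nonneg_ae ((C / c) ^ 2)
    (fun n ↦ (hjap _).continuousOn.integrableOn_compact (isCompact_closedBall _ _))
    (Filter.Eventually.of_forall fun y ↦ Real.rpow_nonneg (jap_pos y).le _)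
    ((Filter.eventually_gt_atTop 0).mono fun n hn ↦ ?_))
  have hn : (0 : ℝ) < n := Nat.cast_pos.2 hn
  let φ : ContDiffBump (0 : EuclideanSpace ℝ (Fin 3)) := ⟨n, n + 1, hn, by linarith⟩
  set f : EuclideanSpace ℝ (Fin 3) → ℝ := fun y ↦ φ y * jap y ^ (-(3 / 2) : ℝ) with hfdef
  have hf : ContDiff ℝ (⊤ : ℕ∞) f := φ.contDiff.mul (contDiff_jap_rpow _)
  have hfs : HasCompactSupport f := φ.hasCompactSupport.mul_right
  have hf0 (y) : 0 ≤ f y := mul_nonneg φ.nonneg (hw0 y)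
  have hfw : Integrable fun y ↦ jap y ^ (-(3 / 2) : ℝ) * f y :=
    ((hjap _).mul hf.continuous).integrable_of_hasCompactSupport hfs.mul_left
  have hf2 : MemLp f 2 volume := hf.continuous.memLp_of_hasCompactSupport hfs
  have hIJ : ∫ y, f y ^ 2 ≤ ∫ y, jap y ^ (-(3 / 2) : ℝ) * f y := by
    refine integral_mono hf2.integrable_sq hfw fun y ↦ ?_
    have : f y ≤ jap y ^ (-(3 / 2) : ℝ) := mul_le_of_le_one_left (hw0 y) φ.le_one
    nlinarith [hf0 y]
  have hlow : ENNReal.ofReal (c * ∫ y, jap y ^ (-(3 / 2) : ℝ) * f y) ≤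
      eLpNorm (K α β f) 2 volume := by
    set A := 2 ^ (-|α|) * ((8 * π)⁻¹ * ∫ y, jap y ^ (-(3 / 2) : ℝ) * f y) with hA
    have hA0 : 0 ≤ A := mul_nonneg (by positivity) (mul_nonneg (by positivity)
      (integral_nonneg fun y ↦ mul_nonneg (hw0 y) (hf0 y)))
    calc _ = eLpNorm (B.indicator fun _ ↦ A) 2 volume := by
          rw [eLpNorm_two_eq_sqrt (memLp_indicator_const 2 hBm A (Or.inr hBfin))]
          have : (fun y ↦ (B.indicator (fun _ ↦ A) y) ^ 2) = B.indicator fun _ ↦ A ^ 2 := by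
            ext y; by_cases hy : y ∈ B <;> simp [hy]
          rw [this, integral_indicator_const _ hBm, smul_eq_mul, Real.sqrt_mul (by positivity),
            Real.sqrt_sq hA0]
          congr 1
          simp only [c, hA]; ring
      _ ≤ _ := by
          refine eLpNorm_mono fun x ↦ ?_
          by_cases hx : x ∈ B
          · rw [Set.indicator_of_mem hx, Real.norm_of_nonneg hA0]
            exact (le_K_of_norm_le_one hβ hf.continuous hfs hf0 (by simpa [B] using hx)).trans
              (le_abs_self _)
          · simp [hx]
  have hmain := hlow.trans (h f hf hfs hf0)
  rw [eLpNorm_two_eq_sqrt hf2, ← ENNReal.ofReal_mul hC.le,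
    ENNReal.ofReal_le_ofReal_iff (by positivity)] at hmain
  have hI0 : 0 ≤ ∫ y, f y ^ 2 := integral_nonneg fun y ↦ sq_nonneg _
  have hbound : ∫ y, f y ^ 2 ≤ (C / c) ^ 2 := by
    have h1 := (mul_le_mul_of_nonneg_left hIJ hc.le).trans hmain
    rcases hI0.eq_or_lt with h0 | h0
    · rw [← h0]; positivity
    · rw [← Real.sqrt_le_left (by positivity), le_div_iff₀ hc]
      refine le_of_mul_le_mul_right ?_ (Real.sqrt_pos.2 h0)
      calc _ = c * (√(∫ y, f y ^ 2) * √(∫ y, f y ^ 2)) := by ring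
        _ ≤ _ := by rwa [Real.mul_self_sqrt hI0]
  calc ∫ y in Metric.closedBall 0 (n : ℝ), jap y ^ (-3 : ℝ)
      = ∫ y in Metric.closedBall 0 (n : ℝ), f y ^ 2 :=
        setIntegral_congr_fun Metric.isClosed_closedBall.measurableSet fun y hy ↦ by
          simp only [hfdef, φ.one_of_mem_closedBall hy, one_mul, hw2]
    _ ≤ ∫ y, f y ^ 2 := setIntegral_le_integral hf2.integrable_sq
        (Filter.Eventually.of_forall fun y ↦ sq_nonneg _)
    _ ≤ _ := hbound
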